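/- arXiv:0707.1313 — 2 statements merged into one kernel-verified Lean document; each statement's English description precedes it below -/
import Mathlib

section
/- Let d ≥ 2 be an integer, X a Polish space, and A an analytic subset of X^d (with the product topology). Then exactly one of the following holds: (a) there is a Borel map c : X → ℕ such that for every tuple (x_i)_{i<d} ∈ A the values c(x_i) are not all equal; (b) there is a continuous map u : d^ω → X such that for every tuple (γ_i)_{i<d} ∈ 𝔸_d, the tuple (u(γ_i))_{i<d} belongs to A. -/
open Set

/-- Concatenation `s ⌢ γ` of a finite sequence with an infinite sequence. -/
def cat {α : Type*} (s : List α) (γ : ℕ → α) : ℕ → α :=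
  fun k => if h : k < s.length then s.get ⟨k, h⟩ else γ (k - s.length)

/-- The set `𝔸_d ⊆ (d^ω)^d` associated with the dense sequence `s` in `d^{<ω}`. -/
def Ad (d : ℕ) (s : ℕ → List (Fin d)) : Set (Fin d → ℕ → Fin d) :=
  {x | ∃ n γ, ∀ i, x i = cat (s n ++ [i]) γ}

section Coloring

open MeasureTheory

variable {ι X : Type*} {A : Set (ι → X)}

/-- `B` contains no full tuple of the hypergraph `A`. -/
def IsIndepSet (A : Set (ι → X)) (B : Set X) : Prop :=
  ∀ x ∈ A, ¬ ∀ i, x i ∈ B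

/-- `B` is a countable union of measurable `A`-independent sets. -/
def IsBorelColorable [MeasurableSpace X] (A : Set (ι → X)) (B : Set X) : Prop :=
  ∃ 𝒞 : Set (Set X), 𝒞.Countable ∧ (∀ C ∈ 𝒞, MeasurableSet C ∧ IsIndepSet A C) ∧ B = ⋃₀ 𝒞

section

variable [MeasurableSpace X]

lemma IsBorelColorable.measurableSet {B : Set X} (h : IsBorelColorable A B) :
    MeasurableSet B := by
  obtain ⟨𝒞, h𝒞, hC, rfl⟩ := h
  exact MeasurableSet.sUnion h𝒞 fun C hC' => (hC C hC').1

lemma IsIndepSet.isBorelColorable {B : Set X} (h : IsIndepSet A B) (hB : MeasurableSet B) :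
    IsBorelColorable A B :=
  ⟨{B}, countable_singleton B, by simpa using ⟨hB, h⟩, by simp⟩

lemma IsBorelColorable.empty : IsBorelColorable A ∅ :=
  ⟨∅, countable_empty, by simp, by simp⟩

lemma IsBorelColorable.iUnion {κ : Type*} [Countable κ] {B : κ → Set X}
    (h : ∀ k, IsBorelColorable A (B k)) : IsBorelColorable A (⋃ k, B k) := by
  choose 𝒞 h𝒞 hC hB using h
  refine ⟨⋃ k, 𝒞 k, countable_iUnion h𝒞, ?_, ?_⟩
  · intro C hC'
    obtain ⟨k, hk⟩ := mem_iUnion.1 hC'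
    exact hC k C hk
  · rw [sUnion_iUnion]
    exact iUnion_congr hB

lemma IsBorelColorable.union {B B' : Set X} (h : IsBorelColorable A B)
    (h' : IsBorelColorable A B') : IsBorelColorable A (B ∪ B') := by
  rw [union_eq_iUnion]
  exact .iUnion fun b => by cases b <;> assumption

lemma IsBorelColorable.exists_measurable_coloring [Nonempty ι]
    (h : IsBorelColorable A univ) :
    ∃ c : X → ℕ, Measurable c ∧ ∀ x ∈ A, ¬ ∀ i j, c (x i) = c (x j) := by
  classical
  obtain ⟨𝒞, h𝒞, hC, hU⟩ := h
  have hempty : IsIndepSet A ∅ := fun x _ h => h (Classical.arbitrary ι)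
  obtain ⟨C, hCr⟩ := (h𝒞.insert ∅).exists_eq_range (insert_nonempty _ _)
  have hCn : ∀ n, MeasurableSet (C n) ∧ IsIndepSet A (C n) := by
    intro n
    have : C n ∈ insert ∅ 𝒞 := hCr ▸ mem_range_self n
    rcases this with h | h
    · rw [h]; exact ⟨.empty, hempty⟩
    · exact hC _ h
  have hcov : ∀ x, ∃ n, x ∈ C n := by
    intro x
    obtain ⟨D, hD, hx⟩ : x ∈ ⋃₀ 𝒞 := hU ▸ mem_univ x
    obtain ⟨n, rfl⟩ : D ∈ range C := hCr ▸ mem_insert_of_mem _ hD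
    exact ⟨n, hx⟩
  refine ⟨fun x => Nat.find (hcov x), measurable_find hcov fun n => (hCn n).1, ?_⟩
  intro x hx heq
  let i₀ := Classical.arbitrary ι
  refine (hCn (Nat.find (hcov (x i₀)))).2 x hx fun i => ?_
  have hi : Nat.find (hcov (x i)) = Nat.find (hcov (x i₀)) := heq i i₀
  rw [← hi]
  exact Nat.find_spec (hcov (x i))

end

lemma MeasureTheory.AnalyticSet.inter {Y : Type*} [TopologicalSpace Y] [T2Space Y] {S T : Set Y}
    (hS : AnalyticSet S) (hT : AnalyticSet T) : AnalyticSet (S ∩ T) := by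
  rw [inter_eq_iInter]
  exact .iInter fun b => by cases b <;> assumption

/-- An analytic independent set of an analytic hypergraph lies in a Borel independent set. -/
lemma IsIndepSet.exists_measurableSet [Finite ι] [TopologicalSpace X] [PolishSpace X]
    [MeasurableSpace X] [BorelSpace X] (hA : AnalyticSet A) {S : Set X} (hS : AnalyticSet S)
    (h : IsIndepSet A S) : ∃ B, MeasurableSet B ∧ S ⊆ B ∧ IsIndepSet A B := by
  classical
  cases nonempty_fintype ι
  suffices H : ∀ F : Finset ι, ∃ B, MeasurableSet B ∧ S ⊆ B ∧
      ∀ x ∈ A, ¬ ∀ i, (i ∈ F → x i ∈ B) ∧ (i ∉ F → x i ∈ S) by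
    obtain ⟨B, hB, hSB, hAB⟩ := H Finset.univ
    exact ⟨B, hB, hSB, fun x hx hxB => hAB x hx fun i => ⟨fun _ => hxB i, by simp⟩⟩
  intro F
  induction F using Finset.induction_on with
  | empty => exact ⟨univ, .univ, subset_univ _, by simpa [IsIndepSet] using h⟩
  | insert m F hm ih =>
    obtain ⟨B, hB, hSB, hAB⟩ := ih
    let T : Set (ι → X) :=
      A ∩ ⋂ i, (fun x => x i) ⁻¹' (if i = m then univ else if i ∈ F then B else S)
    have hT : AnalyticSet T := by
      have : Nonempty ι := ⟨m⟩
      refine hA.inter (.iInter fun i => AnalyticSet.preimage ?_ (continuous_apply i))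
      split_ifs
      exacts [MeasurableSet.univ.analyticSet, hB.analyticSet, hS]
    have hdisj : Disjoint S ((fun x => x m) '' T) := by
      rw [Set.disjoint_left]
      rintro _ hyS ⟨x, ⟨hxA, hx⟩, rfl⟩
      refine hAB x hxA fun i => ?_
      have hi := mem_iInter.1 hx i
      by_cases him : i = m
      · subst him
        exact ⟨fun h => (hm h).elim, fun _ => hyS⟩
      · by_cases hiF : i ∈ F <;> simpa [him, hiF] using hi
    obtain ⟨B', hSB', hB'T, hB'⟩ :=
      hS.measurablySeparable (hT.image_of_continuous (continuous_apply m)) hdisj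
    refine ⟨B ∩ B', hB.inter hB', subset_inter hSB hSB', fun x hxA hx => ?_⟩
    refine Set.disjoint_left.1 hB'T ⟨x, ⟨hxA, mem_iInter.2 fun i => ?_⟩, rfl⟩
      ((hx m).1 (Finset.mem_insert_self m F)).2
    by_cases him : i = m
    · simp [him]
    · by_cases hiF : i ∈ F
      · simpa [him, hiF] using ((hx i).1 (Finset.mem_insert_of_mem hiF)).1
      · simpa [him, hiF] using (hx i).2 (by simp [him, hiF])

end Coloring

section Cylinder

variable {α : Type*}

/-- The initial segment of length `n` of an infinite sequence. -/
def initSeg (γ : ℕ → α) (n : ℕ) : List α := (List.range n).map γ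

@[simp] lemma length_initSeg (γ : ℕ → α) (n : ℕ) : (initSeg γ n).length = n := by
  simp [initSeg]

lemma initSeg_succ (γ : ℕ → α) (n : ℕ) : initSeg γ (n + 1) = initSeg γ n ++ [γ n] := by
  simp [initSeg, List.range_succ]

lemma initSeg_succ' (γ : ℕ → α) (n : ℕ) :
    initSeg γ (n + 1) = γ 0 :: initSeg (fun k => γ (k + 1)) n := by
  simp [initSeg, List.range_succ_eq_map, Function.comp_def]

lemma initSeg_congr {γ δ : ℕ → α} {n : ℕ} (h : ∀ k < n, γ k = δ k) :
    initSeg γ n = initSeg δ n :=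
  List.map_congr_left fun k hk => h k (List.mem_range.1 hk)

lemma initSeg_prefix (γ : ℕ → α) {m n : ℕ} (h : m ≤ n) : initSeg γ m <+: initSeg γ n := by
  induction n, h using Nat.le_induction with
  | base => exact List.prefix_refl _
  | succ n _ ih => exact ih.trans (initSeg_succ γ n ▸ List.prefix_append _ _)

lemma cat_apply_lt (s : List α) (γ : ℕ → α) {k : ℕ} (h : k < s.length) : cat s γ k = s[k] := by
  simp [cat, h]

lemma cat_apply_add (s : List α) (γ : ℕ → α) (k : ℕ) : cat s γ (s.length + k) = γ k := by
  simp [cat]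

lemma initSeg_cat_length (s : List α) (γ : ℕ → α) : initSeg (cat s γ) s.length = s := by
  refine List.ext_getElem (by simp) fun k _ h => ?_
  simp [initSeg, cat_apply_lt s γ h]

lemma initSeg_cat (s : List α) (γ : ℕ → α) (m : ℕ) :
    initSeg (cat s γ) (s.length + m) = s ++ initSeg γ m := by
  induction m with
  | zero => simpa [initSeg] using initSeg_cat_length s γ
  | succ m ih => rw [← add_assoc, initSeg_succ, ih, initSeg_succ, cat_apply_add, List.append_assoc]

variable [TopologicalSpace α]

lemma continuous_cat (s : List α) : Continuous (cat s) := by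
  refine continuous_pi fun k => ?_
  by_cases h : k < s.length
  · simp only [cat, h, dif_pos]
    exact continuous_const
  · simp only [cat, h, dif_neg, not_false_eq_true]
    exact continuous_apply _

lemma isOpenMap_cat [DiscreteTopology α] (s : List α) : IsOpenMap (cat s) := by
  intro V hV
  have : cat s '' V = (⋂ k : Fin s.length, {δ | δ k = s[k]}) ∩
      (fun (δ : ℕ → α) k => δ (s.length + k)) ⁻¹' V := by
    ext δ
    constructor
    · rintro ⟨γ, hγ, rfl⟩
      refine ⟨mem_iInter.2 fun k => cat_apply_lt s γ k.2, ?_⟩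
      simpa [cat_apply_add] using hγ
    · rintro ⟨h, hδ⟩
      refine ⟨_, hδ, funext fun k => ?_⟩
      by_cases hk : k < s.length
      · rw [cat_apply_lt _ _ hk]
        exact (mem_iInter.1 h ⟨k, hk⟩).symm
      · obtain ⟨m, rfl⟩ := Nat.exists_eq_add_of_le (not_lt.1 hk)
        rw [cat_apply_add]
  rw [this]
  refine (isOpen_iInter_of_finite fun k => ?_).inter
    (hV.preimage (continuous_pi fun k => continuous_apply _))
  exact isOpen_discrete ({s[k]} : Set α) |>.preimage (continuous_apply (A := fun _ => α) k.1)

lemma exists_initSeg_subset [DiscreteTopology α] {U : Set (ℕ → α)} (hU : IsOpen U) {δ : ℕ → α}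
    (hδ : δ ∈ U) : ∃ n, ∀ γ, initSeg δ n = initSeg γ n → γ ∈ U := by
  obtain ⟨I, V, hV, hIU⟩ := isOpen_pi_iff.1 hU δ hδ
  obtain ⟨n, hn⟩ := I.exists_nat_subset_range
  refine ⟨n, fun γ hγ => hIU fun k hk => ?_⟩
  have hkn := Finset.mem_range.1 (hn hk)
  have : δ k = γ k := by
    simpa [initSeg, hkn] using congrArg (fun l => l[k]?) hγ
  exact this ▸ (hV k hk).2

end Cylinder

open Filter in
lemma not_colorable_Ad {d : ℕ} [Nonempty (Fin d)] {s : ℕ → List (Fin d)}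
    (hdense : ∀ t : List (Fin d), ∃ n, t <+: s n) [MeasurableSpace (ℕ → Fin d)]
    [BorelSpace (ℕ → Fin d)] {c : (ℕ → Fin d) → ℕ} (hc : Measurable c) :
    ∃ γ ∈ Ad d s, ∀ i j, c (γ i) = c (γ j) := by
  choose U hU hcU using fun m =>
    MeasurableSet.residualEq_isOpen (hc (measurableSet_singleton m))
  obtain ⟨m, hm⟩ : ∃ m, (U m).Nonempty := by
    by_contra! hempty
    have h : ∀ᶠ γ in residual (ℕ → Fin d), ∀ m, γ ∈ c ⁻¹' {m} ↔ γ ∈ U m :=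
      eventually_countable_forall.2 fun m => (hcU m).mem_iff
    obtain ⟨γ, hγ⟩ := (dense_of_mem_residual h).nonempty
    simpa [hempty] using hγ (c γ)
  obtain ⟨δ, hδ⟩ := hm
  obtain ⟨N, hN⟩ := exists_initSeg_subset (hU m) hδ
  obtain ⟨n, hn⟩ := hdense (initSeg δ N)
  have h : ∀ᶠ γ in residual (ℕ → Fin d), ∀ i : Fin d,
      cat (s n ++ [i]) γ ∈ c ⁻¹' {m} ↔ cat (s n ++ [i]) γ ∈ U m :=
    eventually_countable_forall.2 fun i =>
      (tendsto_residual_of_isOpenMap (continuous_cat _) (isOpenMap_cat _)).eventually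
        (hcU m).mem_iff
  obtain ⟨γ, hγ⟩ := (dense_of_mem_residual h).nonempty
  have hcm : ∀ i, c (cat (s n ++ [i]) γ) = m := fun i => by
    refine (hγ i).2 (hN _ ?_)
    have hpre : initSeg δ N <+: s n ++ [i] := hn.trans (List.prefix_append _ _)
    have hle : N ≤ (s n ++ [i]).length := by simpa using hpre.length_le
    have hpre' : initSeg (cat (s n ++ [i]) γ) N <+: s n ++ [i] := by
      conv_rhs => rw [← initSeg_cat_length (s n ++ [i]) γ]
      exact initSeg_prefix _ hle
    exact (List.prefix_of_prefix_length_le hpre hpre' (by simp)).eq_of_length (by simp)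
  exact ⟨_, ⟨n, γ, fun i => rfl⟩, fun i j => by rw [hcm, hcm]⟩

section Homomorphism

open MeasureTheory Filter Topology

variable {d : ℕ} {X : Type*}

/-- Codes, indexed by `k` and a word `t`, for the edges `(s k ⌢ i ⌢ t)_{i < d}`. -/
abbrev EdgeCode (d : ℕ) := ℕ → List (Fin d) → ℕ → ℕ

/-- The labellings `h.1` of words by points of `X`, together with codes `h.2` witnessing that the
words of length `n` are mapped homomorphically into the range of `f`, where the codes agree with
`p` on their first `n` digits. -/
def approxHoms (s : ℕ → List (Fin d)) (f : (ℕ → ℕ) → Fin d → X) (n : ℕ) (p : EdgeCode d) :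
    Set ((List (Fin d) → X) × EdgeCode d) :=
  {h | ∀ k t, t.length + k + 1 = n →
    (∀ i, h.1 (s k ++ i :: t) = f (h.2 k t) i) ∧ ∀ j < n, h.2 k t j = p k t j}

/-- No Borel colorable set meets the range on words of length `n` of every element of `H`. -/
def IsLarge [MeasurableSpace X] (A : Set (Fin d → X)) (n : ℕ)
    (H : Set ((List (Fin d) → X) × EdgeCode d)) : Prop :=
  ∀ B, IsBorelColorable A B → ∃ h ∈ H, ∀ v, v.length = n → h.1 v ∉ B

/-- The pattern `q` at level `n + 1` refines the pattern `p` at level `n`. -/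
def Refines (n : ℕ) (q p : EdgeCode d) : Prop :=
  ∀ k t i j, t.length + k + 1 = n → j < n → q k (t ++ [i]) j = p k t j

variable [TopologicalSpace X] {s : ℕ → List (Fin d)} {f : (ℕ → ℕ) → Fin d → X}

lemma isClosed_approxHoms [T2Space X] (hf : Continuous f) (n : ℕ) (p : EdgeCode d) :
    IsClosed (approxHoms s f n p) := by
  simp only [approxHoms, ofPred_forall, ofPred_and]
  refine isClosed_iInter fun k => isClosed_iInter fun t => isClosed_iInter fun _ =>
    (isClosed_iInter fun i => isClosed_eq (by fun_prop) ?_).inter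
      (isClosed_iInter fun j => isClosed_iInter fun _ => isClosed_eq (by fun_prop) (by fun_prop))
  exact (continuous_apply i).comp (hf.comp (by fun_prop))

variable [PolishSpace X] [MeasurableSpace X] [BorelSpace X]

lemma IsLarge.exists_amalgam [Nonempty (Fin d)] (hlen : ∀ n, (s n).length = n)
    (hf : Continuous f) {n : ℕ} {p : EdgeCode d}
    (hp : IsLarge (range f) n (approxHoms s f n p)) {B : Set X}
    (hB : IsBorelColorable (range f) B) :
    ∃ h, h ∈ approxHoms s f (n + 1) h.2 ∧ Refines n h.2 p ∧
      ∀ v, v.length = n + 1 → h.1 v ∉ B := by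
  let H := approxHoms s f n p ∩ {h | ∀ v, v.length = n → h.1 v ∉ B}
  have hH : AnalyticSet H := by
    have : PolishSpace (EdgeCode d) := inferInstance
    borelize ((List (Fin d) → X) × EdgeCode d)
    refine MeasurableSet.analyticSet ((isClosed_approxHoms hf n p).measurableSet.inter ?_)
    simp only [ofPred_forall]
    refine .iInter fun v => .iInter fun _ => ?_
    have hv : Continuous fun h : (List (Fin d) → X) × EdgeCode d => h.1 v := by fun_prop
    exact hv.measurable hB.measurableSet.compl
  have hS : AnalyticSet ((fun h => h.1 (s n)) '' H) :=
    hH.image_of_continuous (by fun_prop)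
  have hA : AnalyticSet (range f) := by
    rw [AnalyticSet]; exact .inr ⟨f, hf, rfl⟩
  have hdep : ¬ IsIndepSet (range f) ((fun h => h.1 (s n)) '' H) := by
    intro hind
    obtain ⟨B', hB', hSB', hind'⟩ := hind.exists_measurableSet hA hS
    obtain ⟨h, hh, hv⟩ := hp _ (hB.union (hind'.isBorelColorable hB'))
    exact hv _ (hlen n) (.inr (hSB' ⟨h, ⟨hh, fun v hvn hvB => hv v hvn (.inl hvB)⟩, rfl⟩))
  unfold IsIndepSet at hdep
  push Not at hdep
  obtain ⟨_, ⟨a, rfl⟩, ha⟩ := hdep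
  choose g hgH hg using ha
  let i₀ : Fin d := Classical.arbitrary _
  let x : List (Fin d) → X := fun v => (g (v.getLastD i₀)).1 v.dropLast
  let w : EdgeCode d := fun k t => if t = [] then a else (g (t.getLastD i₀)).2 k t.dropLast
  have hx : ∀ v i, x (v ++ [i]) = (g i).1 v := fun v i => by
    simp only [x, List.getLastD_concat, List.dropLast_concat]
  have hw : ∀ k t i, w k (t ++ [i]) = (g i).2 k t := fun k t i => by
    simp only [w, List.getLastD_concat, List.dropLast_concat]; simp
  refine ⟨(x, w), fun k t hkt => ⟨fun i => ?_, fun _ _ => rfl⟩, fun k t i j hkt hj => ?_,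
    fun v hv => ?_⟩
  · rcases List.eq_nil_or_concat' t with rfl | ⟨t, l, rfl⟩
    · obtain rfl : k = n := by simpa using hkt
      simpa [hx, w] using hg i
    · have := ((hgH l).1 k t (by simpa [add_right_comm _ 1] using hkt)).1 i
      change x _ = f (w _ _) i
      rw [← List.cons_append, ← List.append_assoc, hx, hw, this]
  · exact (congrFun (hw k t i) j).trans (((hgH i).1 k t hkt).2 j hj)
  · rcases List.eq_nil_or_concat' v with rfl | ⟨v, l, rfl⟩
    · simp at hv
    · simpa only [hx] using (hgH l).2 v (by simpa using hv)

lemma IsLarge.exists_refines [Nonempty (Fin d)] (hlen : ∀ n, (s n).length = n)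
    (hf : Continuous f) {n : ℕ} {p : EdgeCode d}
    (hp : IsLarge (range f) n (approxHoms s f n p)) :
    ∃ q, Refines n q p ∧ IsLarge (range f) (n + 1) (approxHoms s f (n + 1) q) := by
  classical
  let D : Set (ℕ × List (Fin d) × ℕ) := Iic n ×ˢ {t | t.length ≤ n} ×ˢ Iic n
  have hD : D.Finite :=
    (finite_Iic n).prod ((List.finite_length_le _ n).prod (finite_Iic n))
  have := hD.to_subtype
  let Q : (D → ℕ) → EdgeCode d := fun r k t j =>
    if h : (k, t, j) ∈ D then r ⟨(k, t, j), h⟩ else 0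
  by_contra! hcon
  have hB : ∀ r, ∃ B, IsBorelColorable (range f) B ∧ (Refines n (Q r) p →
      ∀ h ∈ approxHoms s f (n + 1) (Q r), ∃ v, v.length = n + 1 ∧ h.1 v ∈ B) := by
    intro r
    by_cases hr : Refines n (Q r) p
    · have := hcon _ hr
      simp only [IsLarge] at this
      push Not at this
      obtain ⟨B, hB, h⟩ := this
      exact ⟨B, hB, fun _ => h⟩
    · exact ⟨∅, .empty, fun h => (hr h).elim⟩
  choose B hBc hB using hB
  obtain ⟨h, hh, href, hv⟩ := hp.exists_amalgam hlen hf (.iUnion hBc)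
  let r : D → ℕ := fun e => h.2 e.1.1 e.1.2.1 e.1.2.2
  have hQ : ∀ k t j, k ≤ n → t.length ≤ n → j ≤ n → Q r k t j = h.2 k t j :=
    fun k t j hk ht hj => dif_pos (show (k, t, j) ∈ D from ⟨hk, ht, hj⟩)
  obtain ⟨v, hvn, hvB⟩ := hB r
    (fun k t i j hk hj => by
      rw [hQ _ _ _ (by omega) (by simp; omega) (by omega), href k t i j hk hj])
    h fun k t hk => ⟨(hh k t hk).1, fun j hj => (hQ _ _ _ (by omega) (by omega) (by omega)).symm⟩
  exact hv v hvn (mem_iUnion.2 ⟨r, hvB⟩)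

lemma exists_hom_of_not_isBorelColorable [Nonempty (Fin d)] (hlen : ∀ n, (s n).length = n)
    (hf : Continuous f)
    (huniv : ¬ IsBorelColorable (range f) univ) :
    ∃ u : (ℕ → Fin d) → X, Continuous u ∧ ∀ γ ∈ Ad d s, (fun i => u (γ i)) ∈ range f := by
  have hbase : IsLarge (range f) 0 (approxHoms s f 0 0) := by
    intro B hB
    obtain ⟨x, hx⟩ : ∃ x, x ∉ B := by
      by_contra! h
      exact huniv (eq_univ_of_forall h ▸ hB)
    exact ⟨(fun _ => x, 0), fun k t h => by omega, fun _ _ => hx⟩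
  choose! step hstep using fun n (p : EdgeCode d)
    (hp : IsLarge (range f) n (approxHoms s f n p)) => hp.exists_refines hlen hf
  let p : ℕ → EdgeCode d := fun n => n.rec 0 step
  have hlarge : ∀ n, IsLarge (range f) n (approxHoms s f n (p n)) := by
    intro n
    induction n with
    | zero => exact hbase
    | succ n ih => exact (hstep n (p n) ih).2
  have href : ∀ n, Refines n (p (n + 1)) (p n) := fun n => (hstep n (p n) (hlarge n)).1
  choose h hh using fun n =>
    (hlarge n ∅ .empty).imp fun _ h => h.1
  let W : ℕ → (ℕ → Fin d) → ℕ → ℕ := fun k γ j => p (j + k + 1) k (initSeg γ j) j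
  have hW : ∀ k γ j m, j ≤ m → p (m + k + 1) k (initSeg γ m) j = W k γ j := by
    intro k γ j m hm
    induction m, hm using Nat.le_induction with
    | base => rfl
    | succ m hm ih =>
      rw [← ih, initSeg_succ, show m + 1 + k + 1 = (m + k + 1) + 1 by ring]
      exact href (m + k + 1) k (initSeg γ m) _ j (by simp) (by omega)
  have hlim : ∀ k γ, Tendsto (fun m => (h (m + k + 1)).2 k (initSeg γ m)) atTop (𝓝 (W k γ)) := by
    intro k γ
    refine tendsto_pi_nhds.2 fun j => tendsto_const_nhds.congr' ?_
    filter_upwards [eventually_ge_atTop j] with m hm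
    rw [← hW k γ j m hm]
    exact ((hh (m + k + 1) k (initSeg γ m) (by simp)).2 j (by omega)).symm
  have hWc : Continuous (W 0) := by
    refine continuous_pi fun j => ?_
    refine IsLocallyConstant.continuous ((IsLocallyConstant.iff_eventually_eq _).2 fun γ => ?_)
    have : ∀ᶠ δ in 𝓝 γ, ∀ k ∈ Iio j, δ k = γ k :=
      (eventually_all_finite (finite_Iio j)).2 fun k _ =>
        (continuous_apply k).continuousAt.eventually_mem
          ((isOpen_discrete ({γ k} : Set (Fin d))).mem_nhds rfl)
    filter_upwards [this] with δ hδ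
    simp only [W, initSeg_congr hδ]
  let u : (ℕ → Fin d) → X := fun γ => f (W 0 fun k => γ (k + 1)) (γ 0)
  have huc : Continuous u := by
    have h1 : Continuous fun γ : ℕ → Fin d => f (W 0 fun k => γ (k + 1)) :=
      hf.comp (hWc.comp (by fun_prop))
    have h2 : Continuous fun q : (Fin d → X) × Fin d => q.1 q.2 :=
      continuous_prod_of_discrete_right.2 fun i => continuous_apply i
    exact h2.comp (h1.prodMk (continuous_apply 0))
  have hu : ∀ γ, Tendsto (fun m => (h (m + 1)).1 (initSeg γ (m + 1))) atTop (𝓝 (u γ)) := by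
    intro γ
    have := ((continuous_apply (γ 0)).comp hf).continuousAt.tendsto.comp
      (hlim 0 fun k => γ (k + 1))
    refine this.congr fun m => ?_
    have h0 : s 0 = [] := List.length_eq_zero_iff.1 (hlen 0)
    have := (hh (m + 1) 0 (initSeg (fun k => γ (k + 1)) m) (by simp)).1 (γ 0)
    simpa [h0, initSeg_succ'] using this.symm
  refine ⟨u, huc, ?_⟩
  rintro γ ⟨k, δ, hγ⟩
  refine ⟨W k δ, funext fun i => ?_⟩
  have h1 := ((continuous_apply i).comp hf).continuousAt.tendsto.comp (hlim k δ)
  have h2 := (hu (γ i)).comp (tendsto_add_atTop_nat k)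
  refine tendsto_nhds_unique h1 (h2.congr fun m => ?_)
  have hpre : initSeg (γ i) (m + k + 1) = s k ++ i :: initSeg δ m := by
    have := initSeg_cat (s k ++ [i]) δ m
    rw [hγ i, show m + k + 1 = (s k ++ [i]).length + m by simp [hlen]; ring, this]
    simp
  simpa [hpre] using (hh (m + k + 1) k (initSeg δ m) (by simp)).1 i

end Homomorphism

theorem stmt2 (d : ℕ) (hd : 2 ≤ d) (s : ℕ → List (Fin d))
    (hlen : ∀ n, (s n).length = n)
    (hdense : ∀ t : List (Fin d), ∃ n, t <+: s n)
    (X : Type*) [TopologicalSpace X] [PolishSpace X]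
    [MeasurableSpace X] [BorelSpace X]
    (A : Set (Fin d → X)) (hA : MeasureTheory.AnalyticSet A) :
    Xor'
      (∃ c : X → ℕ, Measurable c ∧ ∀ x ∈ A, ¬ ∀ i j, c (x i) = c (x j))
      (∃ u : (ℕ → Fin d) → X, Continuous u ∧
        ∀ γ ∈ Ad d s, (fun i => u (γ i)) ∈ A) := by
  have : Nonempty (Fin d) := ⟨⟨0, by omega⟩⟩
  refine (xor_iff_or_and_not_and _ _).2 ⟨?_, ?_⟩
  · rw [MeasureTheory.AnalyticSet] at hA
    obtain rfl | ⟨f, hf, rfl⟩ := hA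
    · exact .inl ⟨fun _ => 0, measurable_const, by simp⟩
    · by_cases h : IsBorelColorable (range f) univ
      · exact .inl h.exists_measurable_coloring
      · exact .inr (exists_hom_of_not_isBorelColorable hlen hf h)
  · rintro ⟨⟨c, hc, hcA⟩, u, hu, huA⟩
    borelize (ℕ → Fin d)
    obtain ⟨γ, hγ, h⟩ := not_colorable_Ad hdense (hc.comp hu.measurable)
    exact hcA _ (huA γ hγ) h
end

section
/- There exists a Baire-measurable map u : ω^ω → ω^ω with range contained in 𝔾 such that for every sequence (γ_i)_{i∈ℕ} ∈ 𝔸_ω, the sequence (u(γ_i))_{i∈ℕ} belongs to 𝔸_ω (and in particular u(γ_i) ∈ 𝔾 for every i). (In the paper's notation: [ω^ω, 𝔸_ω] ⪯_Bm [𝔾, 𝔸_ω ∩ 𝔾^ω].) -/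
open Set

/-- The finite sequence `t` is an initial segment of the infinite sequence `f`. -/
def IsPrefixFun {α : Type*} (t : List α) (f : ℕ → α) : Prop :=
  ∀ k, (h : k < t.length) → f k = t.get ⟨k, h⟩

/-- The set `𝔸_ω ⊆ (ω^ω)^ω` associated with the dense sequence `s`. -/
def Aomega (s : ℕ → List ℕ) : Set (ℕ → ℕ → ℕ) :=
  {x | ∃ n γ, ∀ i, x i = cat (s n ++ [i]) γ}

/-- The set `𝔾 ⊆ ω^ω` associated with the dense sequence `s`. -/
def Gset (s : ℕ → List ℕ) : Set (ℕ → ℕ) :=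
  {α | ∀ m, ∃ n ≥ m, IsPrefixFun (s n ++ [0]) α}

/-- A set has the Baire property if it differs from an open set by a meager set. -/
def HasBaireProperty {α : Type*} [TopologicalSpace α] (S : Set α) : Prop :=
  ∃ U : Set α, IsOpen U ∧ IsMeagre (symmDiff S U)

/-- A map is Baire-measurable if preimages of open sets have the Baire property. -/
def BaireMeasurableFun {α β : Type*} [TopologicalSpace α] [TopologicalSpace β]
    (f : α → β) : Prop :=
  ∀ U : Set β, IsOpen U → HasBaireProperty (f ⁻¹' U)

open Filter Topology

lemma cat_of_lt {α : Type*} {t : List α} {γ : ℕ → α} {k : ℕ} (h : k < t.length) :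
    cat t γ k = t[k] := by
  simp [cat, h]

lemma isPrefixFun_cat {α : Type*} (t : List α) (γ : ℕ → α) : IsPrefixFun t (cat t γ) :=
  fun k h => by simp [cat, h]

lemma IsPrefixFun.exists_eq_cat {α : Type*} {t : List α} {f : ℕ → α} (h : IsPrefixFun t f) :
    ∃ γ, f = cat t γ := by
  refine ⟨fun k => f (k + t.length), funext fun k => ?_⟩
  by_cases hk : k < t.length
  · simpa [cat, hk] using h k hk
  · simp [cat, hk, Nat.sub_add_cancel (not_lt.1 hk)]

lemma cat_append_singleton_length {α : Type*} (t : List α) (i : α) (γ : ℕ → α) :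
    cat (t ++ [i]) γ t.length = i := by
  simp [cat]

lemma cat_append_singleton_of_lt {α : Type*} {t : List α} (i : α) (γ : ℕ → α) {k : ℕ}
    (h : k < t.length) : cat (t ++ [i]) γ k = t[k] := by
  rw [cat_of_lt (by simp; omega), List.getElem_append_left h]

lemma cat_append_singleton_of_ne {α : Type*} {t : List α} (i j : α) (γ : ℕ → α) {k : ℕ}
    (h : k ≠ t.length) : cat (t ++ [i]) γ k = cat (t ++ [j]) γ k := by
  rcases lt_or_gt_of_ne h with h | h
  · rw [cat_append_singleton_of_lt i γ h, cat_append_singleton_of_lt j γ h]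
  · have : ¬ k < t.length + 1 := by omega
    simp [cat, this]

lemma cat_append_singleton_eventuallyEq {α : Type*} (t : List α) (i j : α) (γ : ℕ → α) :
    cat (t ++ [i]) γ =ᶠ[atTop] cat (t ++ [j]) γ := by
  filter_upwards [eventually_gt_atTop t.length] with k hk
  exact cat_append_singleton_of_ne i j γ hk.ne'

/-- The sequences all of whose finite modifications have, for every `i`, infinitely many initial
segments of the form `s n ⌢ i`. -/
def genericSet (s : ℕ → List ℕ) : Set (ℕ → ℕ) :=
  {α | ∀ β, β =ᶠ[atTop] α → ∀ i m, ∃ n ≥ m, IsPrefixFun (s n ++ [i]) β}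

lemma mem_genericSet_of_eventuallyEq {s : ℕ → List ℕ} {α β : ℕ → ℕ} (h : β =ᶠ[atTop] α)
    (hα : α ∈ genericSet s) : β ∈ genericSet s :=
  fun δ hδ => hα δ (hδ.trans h)

lemma genericSet_subset_Gset (s : ℕ → List ℕ) : genericSet s ⊆ Gset s :=
  fun α hα => hα α EventuallyEq.rfl 0

lemma isOpen_setOf_isPrefixFun (t : List ℕ) : IsOpen {f : ℕ → ℕ | IsPrefixFun t f} := by
  have : {f : ℕ → ℕ | IsPrefixFun t f} =
      ⋂ k : Fin t.length, (fun f : ℕ → ℕ => f k) ⁻¹' {t.get k} := by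
    ext f
    simp [IsPrefixFun, Fin.forall_iff]
  rw [this]
  exact isOpen_iInter_of_finite fun k => (isOpen_discrete _).preimage (continuous_apply _)

/-- Replace an initial segment of `α` by `t`. -/
def overwrite (t : List ℕ) (α : ℕ → ℕ) : ℕ → ℕ :=
  cat t fun k => α (k + t.length)

lemma overwrite_of_le {t : List ℕ} {α : ℕ → ℕ} {k : ℕ} (h : t.length ≤ k) :
    overwrite t α k = α k := by
  simp [overwrite, cat, not_lt.2 h, Nat.sub_add_cancel h]

lemma overwrite_of_lt {t : List ℕ} {α : ℕ → ℕ} {k : ℕ} (h : k < t.length) :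
    overwrite t α k = t[k] :=
  cat_of_lt h

lemma continuous_overwrite (t : List ℕ) : Continuous (overwrite t) := by
  refine continuous_pi fun k => ?_
  rcases lt_or_ge k t.length with h | h
  · simp_rw [overwrite_of_lt h]
    exact continuous_const
  · simp_rw [overwrite_of_le h]
    exact continuous_apply k

lemma exists_eq_overwrite {α β : ℕ → ℕ} (h : β =ᶠ[atTop] α) : ∃ t, β = overwrite t α := by
  obtain ⟨N, hN⟩ := eventually_atTop.1 h
  refine ⟨(List.range N).map β, funext fun k => ?_⟩
  rcases lt_or_ge k N with hk | hk
  · rw [overwrite_of_lt (by simpa using hk)]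
    simp
  · rw [overwrite_of_le (by simpa using hk), hN k hk]

lemma dense_setOf_exists_isPrefixFun_overwrite {s : ℕ → List ℕ} (hlen : ∀ n, (s n).length = n)
    (hdense : ∀ t : List ℕ, ∃ n, t <+: s n) (t : List ℕ) (i m : ℕ) :
    Dense {α | ∃ n ≥ m, IsPrefixFun (s n ++ [i]) (overwrite t α)} := by
  intro α
  rw [mem_closure_iff_nhds]
  intro U hU
  obtain ⟨I, V, hV, hVU⟩ : ∃ (I : Finset ℕ) (V : ℕ → Set ℕ), (∀ k, V k ∈ 𝓝 (α k)) ∧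
      (I : Set ℕ).pi V ⊆ U := by
    rw [nhds_pi, Filter.mem_pi'] at hU
    exact hU
  set N := max (I.sup id + 1) (max t.length m) with hN
  obtain ⟨n, hn⟩ := hdense ((List.range N).map (overwrite t α))
  have hNn : N ≤ n := by simpa [hlen] using hn.length_le
  have hs : ∀ k (hk : k < N), (s n)[k]'(by rw [hlen]; omega) = overwrite t α k := by
    intro k hk
    have := hn.getElem (i := k) (by simpa using hk)
    simpa using this.symm
  refine ⟨fun k => if k < N then α k else cat (s n ++ [i]) 0 k, hVU fun k hk => ?_,
    n, by omega, ?_⟩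
  · have : k ≤ I.sup id := Finset.le_sup (f := id) hk
    rw [if_pos (by omega)]
    exact mem_of_mem_nhds (hV k)
  · convert isPrefixFun_cat (s n ++ [i]) 0 using 1
    funext k
    rcases lt_or_ge k N with hk | hk
    · rw [cat_append_singleton_of_lt i 0 (by rw [hlen]; omega), hs k hk]
      rcases lt_or_ge k t.length with h | h
      · rw [overwrite_of_lt h, overwrite_of_lt h]
      · rw [overwrite_of_le h, overwrite_of_le h, if_pos hk]
    · rw [overwrite_of_le (by omega), if_neg (by omega)]

lemma genericSet_mem_residual {s : ℕ → List ℕ} (hlen : ∀ n, (s n).length = n)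
    (hdense : ∀ t : List ℕ, ∃ n, t <+: s n) : genericSet s ∈ residual (ℕ → ℕ) := by
  have key : ∀ (t : List ℕ) (i m : ℕ),
      {α | ∃ n ≥ m, IsPrefixFun (s n ++ [i]) (overwrite t α)} ∈ residual (ℕ → ℕ) := by
    intro t i m
    refine residual_of_dense_open ?_
      (dense_setOf_exists_isPrefixFun_overwrite hlen hdense t i m)
    have : {α | ∃ n ≥ m, IsPrefixFun (s n ++ [i]) (overwrite t α)} =
        ⋃ n ≥ m, overwrite t ⁻¹' {f | IsPrefixFun (s n ++ [i]) f} := by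
      ext; simp
    rw [this]
    exact isOpen_biUnion fun n _ =>
      (isOpen_setOf_isPrefixFun _).preimage (continuous_overwrite t)
  have hall : ∀ᶠ α in residual (ℕ → ℕ), ∀ (t : List ℕ) (i m : ℕ),
      ∃ n ≥ m, IsPrefixFun (s n ++ [i]) (overwrite t α) := by
    simp_rw [eventually_countable_forall]
    exact key
  filter_upwards [hall] with α hα β hβ i m
  obtain ⟨t, rfl⟩ := exists_eq_overwrite hβ
  exact hα t i m

/-- `H` takes values in `C`, depends only on the first `n` coordinates, and maps the hyperedges
of `Aomega s` branching below level `n` to elements of `Aomega s`. -/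
structure IsLevelHom (s : ℕ → List ℕ) (C : Set (ℕ → ℕ)) (n : ℕ) (H : (ℕ → ℕ) → ℕ → ℕ) :
    Prop where
  mem : ∀ β, H β ∈ C
  congr : ∀ β β', (∀ k < n, β k = β' k) → H β = H β'
  map_edge : ∀ k < n, ∀ γ, (fun i => H (cat (s k ++ [i]) γ)) ∈ Aomega s

lemma IsLevelHom.exists_succ {s : ℕ → List ℕ} (hlen : ∀ n, (s n).length = n) {n : ℕ}
    {H : (ℕ → ℕ) → ℕ → ℕ} (hH : IsLevelHom s (genericSet s) n H)
    (hex : ∀ β, ∀ v ∈ genericSet s, ∃ H', IsLevelHom s (genericSet s) n H' ∧ H' β = v) (i₀ : ℕ) :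
    ∃ H', IsLevelHom s (genericSet s) (n + 1) H' ∧ ∀ β, β n = i₀ → H' β = H β := by
  obtain ⟨m, -, hm⟩ := hH.mem (cat (s n) 0) _ EventuallyEq.rfl i₀ 0
  obtain ⟨γ', hγ'⟩ := hm.exists_eq_cat
  have hmem : ∀ i, cat (s m ++ [i]) γ' ∈ genericSet s := fun i =>
    mem_genericSet_of_eventuallyEq (cat_append_singleton_eventuallyEq _ i i₀ _)
      (hγ' ▸ hH.mem _)
  have hK : ∀ i, ∃ K, IsLevelHom s (genericSet s) n K ∧
      K (cat (s n) 0) = cat (s m ++ [i]) γ' ∧ (i = i₀ → K = H) := by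
    intro i
    by_cases hi : i = i₀
    · subst hi
      exact ⟨H, hH, hγ', fun _ => rfl⟩
    · obtain ⟨K, hK, hK'⟩ := hex (cat (s n) 0) _ (hmem i)
      exact ⟨K, hK, hK', fun h => absurd h hi⟩
  choose K hK hKv hK₀ using hK
  refine ⟨fun β => K (β n) β, ⟨fun β => (hK _).mem _, fun β β' h => ?_, fun k hk γ => ?_⟩,
    fun β hβ => by simp only [hK₀ _ hβ]⟩
  · simp only [h n n.lt_succ_self]
    exact (hK _).congr _ _ fun k hk => h k (hk.trans n.lt_succ_self)
  · rcases Nat.lt_succ_iff_lt_or_eq.1 hk with hk | rfl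
    · have : ∀ i, cat (s k ++ [i]) γ n = cat (s k ++ [0]) γ n := fun i =>
        cat_append_singleton_of_ne i 0 γ (by rw [hlen]; omega)
      simp only [this]
      exact (hK _).map_edge k hk γ
    · refine ⟨m, γ', fun i => ?_⟩
      have : cat (s k ++ [i]) γ k = i := by
        simpa only [hlen] using cat_append_singleton_length (s k) i γ
      simp only [this]
      rw [← hKv i]
      refine (hK i).congr _ _ fun j hj => ?_
      have hj' : j < (s k).length := by rwa [hlen]
      rw [cat_append_singleton_of_lt i γ hj', cat_of_lt hj']

lemma exists_isLevelHom_apply_eq {s : ℕ → List ℕ} (hlen : ∀ n, (s n).length = n) (n : ℕ)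
    (β : ℕ → ℕ) {v : ℕ → ℕ} (hv : v ∈ genericSet s) :
    ∃ H, IsLevelHom s (genericSet s) n H ∧ H β = v := by
  induction n generalizing β v with
  | zero => exact ⟨fun _ => v, ⟨fun _ => hv, fun _ _ _ => rfl, fun k hk => by omega⟩, rfl⟩
  | succ n ih =>
    obtain ⟨H, hH, hHv⟩ := ih β hv
    obtain ⟨H', hH', h⟩ := hH.exists_succ hlen (fun β v hv => ih β hv) (β n)
    exact ⟨H', hH', (h β rfl).trans hHv⟩

/-- Every tail equivalence class admits a homomorphism into the generic set. -/
lemma exists_hom_tail_class {s : ℕ → List ℕ} (hlen : ∀ n, (s n).length = n)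
    (hne : (genericSet s).Nonempty) (α : ℕ → ℕ) :
    ∃ u : (ℕ → ℕ) → ℕ → ℕ, (∀ β, u β ∈ genericSet s) ∧
      ∀ n γ, cat (s n ++ [0]) γ =ᶠ[atTop] α →
        (fun i => u (cat (s n ++ [i]) γ)) ∈ Aomega s := by
  obtain ⟨v, hv⟩ := hne
  have step : ∀ n (H : {H // IsLevelHom s (genericSet s) n H}),
      ∃ H' : {H // IsLevelHom s (genericSet s) (n + 1) H},
        ∀ β, β n = α n → H'.1 β = H.1 β := fun n H => by
    obtain ⟨H', hH', h⟩ := H.2.exists_succ hlen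
      (fun β v hv => exists_isLevelHom_apply_eq hlen n β hv) (α n)
    exact ⟨⟨H', hH'⟩, h⟩
  choose next hnext using step
  obtain ⟨H₀, hH₀, -⟩ := exists_isLevelHom_apply_eq hlen 0 α hv
  let H : ∀ n, {H // IsLevelHom s (genericSet s) n H} := fun n => Nat.rec ⟨H₀, hH₀⟩ next n
  have hstable : ∀ β N, (∀ k ≥ N, β k = α k) → ∀ n ≥ N, (H n).1 β = (H N).1 β := by
    intro β N hN n hn
    induction n, hn using Nat.le_induction with
    | base => rfl
    | succ n hn ih => exact (hnext n (H n) β (hN n hn)).trans ih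
  classical
  let u : (ℕ → ℕ) → ℕ → ℕ := fun β =>
    if h : ∃ N, ∀ k ≥ N, β k = α k then (H h.choose).1 β else v
  have hu : ∀ β N, (∀ k ≥ N, β k = α k) → u β = (H N).1 β := by
    intro β N hN
    have h : ∃ N, ∀ k ≥ N, β k = α k := ⟨N, hN⟩
    simp only [u, dif_pos h]
    rw [← hstable β _ h.choose_spec _ (le_max_left _ N), ← hstable β N hN _ (le_max_right _ _)]
  refine ⟨u, fun β => ?_, fun n γ hγ => ?_⟩
  · by_cases h : ∃ N, ∀ k ≥ N, β k = α k
    · rw [hu β _ h.choose_spec]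
      exact (H _).2.mem β
    · simpa only [u, dif_neg h] using hv
  · obtain ⟨N, hN⟩ := eventually_atTop.1 hγ
    have : ∀ i, u (cat (s n ++ [i]) γ) = (H (max N (n + 1))).1 (cat (s n ++ [i]) γ) :=
      fun i => hu _ _ fun k hk => by
        rw [cat_append_singleton_of_ne i 0 γ (by rw [hlen]; omega), hN k (by omega)]
    simp only [this]
    exact (H _).2.map_edge n (by omega) γ

lemma baireMeasurableFun_of_eqOn_residual {α : Type*} [TopologicalSpace α] {f : α → α}
    {C : Set α} (hC : C ∈ residual α) (hf : ∀ x ∈ C, f x = x) : BaireMeasurableFun f := by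
  refine fun U hU => ⟨U, hU, ?_⟩
  filter_upwards [hC] with x hx
  simp [hf x hx]

theorem stmt6 (s : ℕ → List ℕ)
    (hlen : ∀ n, (s n).length = n)
    (hdense : ∀ t : List ℕ, ∃ n, t <+: s n) :
    ∃ u : (ℕ → ℕ) → (ℕ → ℕ), BaireMeasurableFun u ∧ (∀ α, u α ∈ Gset s) ∧
      ∀ γ ∈ Aomega s,
        (fun i => u (γ i)) ∈ Aomega s ∧ ∀ i, u (γ i) ∈ Gset s := by
  have hres := genericSet_mem_residual hlen hdense
  choose f hfmem hfedge using
    exists_hom_tail_class hlen (dense_of_mem_residual hres).nonempty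
  let rep : (ℕ → ℕ) → ℕ → ℕ := fun α => (Quotient.mk (germSetoid atTop ℕ) α).out
  have hrep : ∀ α, rep α =ᶠ[atTop] α := fun α =>
    Quotient.mk_out (s := germSetoid atTop ℕ) α
  have hrep_congr : ∀ α β, α =ᶠ[atTop] β → rep α = rep β := fun α β h =>
    congrArg Quotient.out (Quotient.sound (s := germSetoid atTop ℕ) h)
  classical
  let u : (ℕ → ℕ) → ℕ → ℕ := fun α => if α ∈ genericSet s then α else f (rep α) α
  have hu : ∀ α, u α ∈ Gset s := by
    intro α
    apply genericSet_subset_Gset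
    by_cases h : α ∈ genericSet s
    · simpa only [u, if_pos h] using h
    · simpa only [u, if_neg h] using hfmem _ _
  refine ⟨u, baireMeasurableFun_of_eqOn_residual hres fun α h => if_pos h, hu,
    fun x hx => ⟨?_, fun i => hu _⟩⟩
  obtain ⟨n, γ, hx⟩ := hx
  simp only [hx]
  have htail := fun i j => cat_append_singleton_eventuallyEq (s n) i j γ
  by_cases h : cat (s n ++ [0]) γ ∈ genericSet s
  · exact ⟨n, γ, fun i => if_pos (mem_genericSet_of_eventuallyEq (htail i 0) h)⟩
  · have : ∀ i, u (cat (s n ++ [i]) γ) =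
        f (rep (cat (s n ++ [0]) γ)) (cat (s n ++ [i]) γ) := fun i => by
      rw [← hrep_congr _ _ (htail i 0)]
      exact if_neg fun h' => h (mem_genericSet_of_eventuallyEq (htail 0 i) h')
    simp only [this]
    exact hfedge _ n γ (hrep _).symm
end
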